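/- For all integers k ≥ 0 and m > k + n there exists C > 0, depending only on n, r, k, m and 𝔅, such that for every p ∈ ℕ, every u ∈ C_c^∞(ℝ^{2n}, ℂ^r), and all indices j_1,…,j_k ∈ {1,…,2n}: sup_{Z ∈ ℝ^{2n}} |∇^{(p)}_{j_1} ⋯ ∇^{(p)}_{j_k} u(Z)| ≤ C p^{(n+k)/2} ‖u‖_{p,m}, where ‖u‖_{p,m}² = Σ_{ℓ=0}^m p^{-ℓ} Σ_{i_1,…,i_ℓ ∈ {1,…,2n}} ‖∇^{(p)}_{i_1} ⋯ ∇^{(p)}_{i_ℓ} u‖²_{L²}. -/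

import Mathlib

open MeasureTheory Matrix

noncomputable section

/-- Magnetic covariant derivative `∇^{(p)}_j u = ∂_j u − (ip/2)(Σ_k B_{kj} Z_k) u`
for the constant-curvature model on `ℝ^{2n}`. -/
def mgd {n : ℕ} {F : Type*} [NormedAddCommGroup F] [NormedSpace ℂ F]
    (B : Matrix (Fin (2*n)) (Fin (2*n)) ℝ) (p : ℕ) (j : Fin (2*n))
    (u : (Fin (2*n) → ℝ) → F) (Z : Fin (2*n) → ℝ) : F :=
  fderiv ℝ u Z (Pi.single j 1) -
    ((Complex.I * (p : ℂ) / 2) * ∑ k, ((B k j : ℝ) : ℂ) * ((Z k : ℝ) : ℂ)) • u Z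

/-- Iterated magnetic covariant derivative `∇_{j_1} ⋯ ∇_{j_k} u` along a list of
indices. -/
def mgdIter {n : ℕ} {F : Type*} [NormedAddCommGroup F] [NormedSpace ℂ F]
    (B : Matrix (Fin (2*n)) (Fin (2*n)) ℝ) (p : ℕ) :
    List (Fin (2*n)) → ((Fin (2*n) → ℝ) → F) → ((Fin (2*n) → ℝ) → F)
  | [], u => u
  | j :: js, u => mgd B p j (mgdIter B p js u)

/-- Square of the rescaled Sobolev norm
`‖u‖_{p,m}² = Σ_{ℓ=0}^m p^{-ℓ} Σ_{i_1,…,i_ℓ} ‖∇_{i_1}⋯∇_{i_ℓ} u‖²_{L²}`. -/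
def sobSq {n r : ℕ} (B : Matrix (Fin (2*n)) (Fin (2*n)) ℝ) (p m : ℕ)
    (u : (Fin (2*n) → ℝ) → EuclideanSpace ℂ (Fin r)) : ℝ :=
  ∑ l ∈ Finset.range (m + 1), ((p : ℝ))⁻¹ ^ l *
    ∑ i : Fin l → Fin (2*n), ∫ Z, ‖mgdIter B p (List.ofFn i) u Z‖ ^ 2

/-- Taylor's formula with integral remainder, as a bound on the initial value in terms of the
derivatives `f l` of `f 0` at `T` and the weighted integral of the next derivative. -/
theorem norm_zero_le_taylor {E : Type*} [NormedAddCommGroup E] [NormedSpace ℝ E] [CompleteSpace E]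
    (f : ℕ → ℝ → E) (hf : ∀ l t, HasDerivAt (f l) (f (l + 1) t) t) {T : ℝ} (hT : 0 ≤ T) (q : ℕ) :
    ‖f 0 0‖ ≤ ∑ l ∈ Finset.range (q + 1), T ^ l * ‖f l T‖ +
      ∫ t in (0 : ℝ)..T, t ^ q * ‖f (q + 1) t‖ := by
  have hc (l : ℕ) : Continuous (f l) :=
    continuous_iff_continuousAt.2 fun t => (hf l t).continuousAt
  have key : ‖f 0 0‖ ≤ ∑ l ∈ Finset.range (q + 1), T ^ l * ‖f l T‖ +
      ‖∫ t in (0 : ℝ)..T, t ^ q • f (q + 1) t‖ := by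
    induction q with
    | zero =>
      have h : ∫ t in (0 : ℝ)..T, f 1 t = f 0 T - f 0 0 :=
        intervalIntegral.integral_eq_sub_of_hasDerivAt (fun t _ => hf 0 t)
          ((hc 1).intervalIntegrable _ _)
      have h' : f 0 0 = f 0 T - ∫ t in (0 : ℝ)..T, f 1 t := by rw [h]; abel
      simpa [← h'] using norm_sub_le (f 0 T) (∫ t in (0 : ℝ)..T, f 1 t)
    | succ q ih =>
      refine ih.trans ?_
      rw [Finset.sum_range_succ _ (q + 1), add_assoc]
      gcongr
      have hq : (0 : ℝ) < q + 1 := by positivity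
      have h := intervalIntegral.integral_smul_deriv_eq_deriv_smul (a := 0) (b := T)
        (u := fun t : ℝ => t ^ (q + 1)) (u' := fun t : ℝ => ((q + 1 : ℕ) : ℝ) * t ^ q)
        (v := f (q + 1)) (v' := f (q + 2))
        (fun t _ => by simpa using hasDerivAt_pow (q + 1) t) (fun t _ => hf (q + 1) t)
        (by apply Continuous.intervalIntegrable; fun_prop) ((hc _).intervalIntegrable _ _)
      simp only [mul_smul, intervalIntegral.integral_smul] at h
      set J := ∫ t in (0 : ℝ)..T, t ^ q • f (q + 1) t
      set K := ∫ t in (0 : ℝ)..T, t ^ (q + 1) • f (q + 2) t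
      have h' : ((q + 1 : ℕ) : ℝ) • J = T ^ (q + 1) • f (q + 1) T - K := by
        rw [h]; simp
      calc ‖J‖ ≤ ((q + 1 : ℕ) : ℝ) * ‖J‖ :=
            le_mul_of_one_le_left (norm_nonneg _) (by push_cast; linarith [q.cast_nonneg (α := ℝ)])
        _ = ‖((q + 1 : ℕ) : ℝ) • J‖ := by rw [norm_smul, Real.norm_natCast]
        _ ≤ ‖T ^ (q + 1) • f (q + 1) T‖ + ‖K‖ := by rw [h']; exact norm_sub_le _ _
        _ = T ^ (q + 1) * ‖f (q + 1) T‖ + ‖K‖ := by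
            rw [norm_smul, norm_pow, Real.norm_of_nonneg hT]
  refine key.trans ?_
  gcongr
  refine (intervalIntegral.norm_integral_le_integral_norm hT).trans_eq ?_
  refine intervalIntegral.integral_congr fun t ht => ?_
  rw [Set.uIcc_of_le hT] at ht
  simp only [norm_smul, norm_pow, Real.norm_of_nonneg ht.1]

theorem volume_unitCube (ι : Type*) [Fintype ι] :
    volume.real (Set.Icc (0 : ι → ℝ) 1) = 1 := by
  simp [Measure.real, Real.volume_Icc_pi_toReal zero_le_one]

/-- The mean of `‖g‖` over a cube of side `t` is controlled by `t ^ (-n)` times the `L²` norm. -/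
theorem integral_unitCube_norm_le {n : ℕ} {F : Type*} [NormedAddCommGroup F]
    {g : (Fin (2 * n) → ℝ) → F} (hg : Continuous g) (hs : HasCompactSupport g)
    (Z : Fin (2 * n) → ℝ) {t : ℝ} (ht : 0 < t) :
    ∫ x in Set.Icc (0 : Fin (2 * n) → ℝ) 1, ‖g (Z + t • x)‖ ≤
      (t ^ n)⁻¹ * √(∫ y, ‖g y‖ ^ 2) := by
  set Q := Set.Icc (0 : Fin (2 * n) → ℝ) 1
  set h : (Fin (2 * n) → ℝ) → ℝ := fun x => ‖g (Z + t • x)‖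
  have hh : Continuous h := by fun_prop
  have hi : IntegrableOn h Q := hh.integrableOn_Icc
  have hi2 : IntegrableOn (fun x => h x ^ 2) Q := (hh.pow 2).integrableOn_Icc
  have hs2 : HasCompactSupport fun y => ‖g y‖ ^ 2 :=
    hs.comp_left (g := fun y => ‖y‖ ^ 2) (by simp)
  have hI : Integrable fun y => ‖g y‖ ^ 2 :=
    (hg.norm.pow 2).integrable_of_hasCompactSupport hs2
  have hIt : Integrable fun x => h x ^ 2 :=
    Integrable.comp_smul (f := fun y => ‖g (Z + y)‖ ^ 2) (hI.comp_add_left Z) ht.ne'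
  have hscale : ∫ x, h x ^ 2 = (t ^ (2 * n))⁻¹ * ∫ y, ‖g y‖ ^ 2 := by
    have := Measure.integral_comp_smul volume (fun y => ‖g (Z + y)‖ ^ 2) t
    rw [integral_add_left_eq_self (fun y => ‖g y‖ ^ 2) Z] at this
    simpa [abs_of_pos ht] using this
  have hvar : (∫ x in Q, h x) ^ 2 ≤ ∫ x in Q, h x ^ 2 := by
    set a := ∫ x in Q, h x
    have h0 : 0 ≤ ∫ x in Q, (h x - a) ^ 2 := integral_nonneg fun x => sq_nonneg _
    have h1 : ∫ x in Q, (h x - a) ^ 2 = (∫ x in Q, h x ^ 2) - 2 * a * a + a ^ 2 := by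
      have hc : IntegrableOn (fun _ => a ^ 2) Q := continuous_const.integrableOn_Icc
      calc ∫ x in Q, (h x - a) ^ 2 = ∫ x in Q, (h x ^ 2 - 2 * a * h x + a ^ 2) := by
            congr 1; ext x; ring
        _ = _ := by
            have hm : IntegrableOn (fun x => 2 * a * h x) Q := hi.const_mul _
            have hd : IntegrableOn (fun x => h x ^ 2 - 2 * a * h x) Q := hi2.sub hm
            rw [integral_add hd hc, integral_sub hi2 hm,
              integral_const_mul, setIntegral_const, volume_unitCube, one_smul]
    nlinarith
  have hsq : (∫ x in Q, h x) ^ 2 ≤ (t ^ (2 * n))⁻¹ * ∫ y, ‖g y‖ ^ 2 :=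
    hvar.trans <| (setIntegral_le_integral hIt (.of_forall fun x => sq_nonneg _)).trans_eq hscale
  refine (Real.le_sqrt_of_sq_le hsq).trans_eq ?_
  have h2n : t ^ (2 * n) = (t ^ n) ^ 2 := by rw [← pow_mul, mul_comm]
  rw [Real.sqrt_mul (by positivity), Real.sqrt_inv, h2n, Real.sqrt_sq (by positivity)]

section MagneticDerivative

variable {n : ℕ} {F : Type*} [NormedAddCommGroup F] [NormedSpace ℂ F]
  {B : Matrix (Fin (2 * n)) (Fin (2 * n)) ℝ} {p : ℕ}

theorem ContDiff.mgd {u : (Fin (2 * n) → ℝ) → F} (hu : ContDiff ℝ (⊤ : ℕ∞) u)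
    (j : Fin (2 * n)) : ContDiff ℝ (⊤ : ℕ∞) (mgd B p j u) := by
  unfold _root_.mgd
  refine ((hu.fderiv_right (m := (⊤ : ℕ∞)) (by simp)).clm_apply contDiff_const).sub
    (ContDiff.smul ?_ hu)
  refine contDiff_const.mul (ContDiff.sum fun k _ => contDiff_const.mul ?_)
  exact Complex.ofRealCLM.contDiff.comp (contDiff_apply ℝ ℝ k)

theorem HasCompactSupport.mgd {u : (Fin (2 * n) → ℝ) → F} (hu : HasCompactSupport u)
    (j : Fin (2 * n)) : HasCompactSupport (mgd B p j u) :=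
  (hu.fderiv_apply ℝ _).sub hu.smul_left

theorem ContDiff.mgdIter {u : (Fin (2 * n) → ℝ) → F} (hu : ContDiff ℝ (⊤ : ℕ∞) u) :
    ∀ js : List (Fin (2 * n)), ContDiff ℝ (⊤ : ℕ∞) (mgdIter B p js u)
  | [] => hu
  | j :: js => (hu.mgdIter js).mgd j

theorem HasCompactSupport.mgdIter {u : (Fin (2 * n) → ℝ) → F} (hu : HasCompactSupport u) :
    ∀ js : List (Fin (2 * n)), HasCompactSupport (mgdIter B p js u)
  | [] => hu
  | j :: js => (hu.mgdIter js).mgd j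

theorem mgdIter_append (js js' : List (Fin (2 * n))) (u : (Fin (2 * n) → ℝ) → F) :
    mgdIter B p (js ++ js') u = mgdIter B p js (mgdIter B p js' u) := by
  induction js with
  | nil => rfl
  | cons j js ih => rw [List.cons_append, mgdIter, mgdIter, ih]

/-- The phase that trivialises the connection along the line `t ↦ Z + t • x`. -/
def radialPhase (B : Matrix (Fin (2 * n)) (Fin (2 * n)) ℝ) (p : ℕ) (Z x : Fin (2 * n) → ℝ) : ℂ :=
  (Complex.I * (p : ℂ) / 2) * ((Z ⬝ᵥ B *ᵥ x : ℝ) : ℂ)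

theorem dotProduct_mulVec_self_of_skew (hB : Bᵀ = -B) (x : Fin (2 * n) → ℝ) :
    x ⬝ᵥ B *ᵥ x = 0 := by
  have h : x ⬝ᵥ B *ᵥ x = -(x ⬝ᵥ B *ᵥ x) := by
    conv_lhs => rw [dotProduct_mulVec, ← mulVec_transpose, hB, neg_mulVec, neg_dotProduct,
      dotProduct_comm]
  linarith

/-- In the radial gauge, differentiating along a line is the covariant derivative in its
direction. -/
theorem hasDerivAt_radial (hB : Bᵀ = -B) {w : (Fin (2 * n) → ℝ) → F} (hw : Differentiable ℝ w)
    (Z x : Fin (2 * n) → ℝ) (t : ℝ) :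
    HasDerivAt (fun t : ℝ => Complex.exp (-(radialPhase B p Z x * t)) • w (Z + t • x))
      (Complex.exp (-(radialPhase B p Z x * t)) • ∑ j, (x j : ℂ) • mgd B p j w (Z + t • x)) t := by
  have h1 : HasDerivAt (fun t : ℝ => w (Z + t • x)) (fderiv ℝ w (Z + t • x) x) t := by
    have hl : HasDerivAt (fun t : ℝ => Z + t • x) x t := by
      simpa using ((hasDerivAt_id t).smul_const x).const_add Z
    exact (hw _).hasFDerivAt.comp_hasDerivAt t hl
  have h2 : HasDerivAt (fun t : ℝ => Complex.exp (-(radialPhase B p Z x * t)))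
      (Complex.exp (-(radialPhase B p Z x * t)) * -(radialPhase B p Z x)) t := by
    have : HasDerivAt (fun t : ℝ => -(radialPhase B p Z x * t)) (-(radialPhase B p Z x)) t := by
      simpa using ((Complex.ofRealCLM.hasDerivAt (x := t)).const_mul (radialPhase B p Z x)).fun_neg
    exact this.cexp
  refine (h2.fun_smul h1).congr_deriv (Eq.symm ?_)
  have hx : fderiv ℝ w (Z + t • x) x =
      ∑ j, (x j : ℂ) • fderiv ℝ w (Z + t • x) (Pi.single j 1) := by
    have (L : (Fin (2 * n) → ℝ) →L[ℝ] F) : L x = ∑ j, (x j : ℂ) • L (Pi.single j 1) := by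
      conv_lhs => rw [pi_eq_sum_univ' x, map_sum]
      exact Finset.sum_congr rfl fun j _ => by rw [map_smul, Complex.coe_smul]
    exact this _
  have hA : ∑ j, (x j : ℂ) * ((Complex.I * (p : ℂ) / 2) *
      ∑ k, ((B k j : ℝ) : ℂ) * (((Z + t • x) k : ℝ) : ℂ)) = radialPhase B p Z x := by
    have hd : (Z + t • x) ⬝ᵥ B *ᵥ x = Z ⬝ᵥ B *ᵥ x := by
      rw [add_dotProduct, smul_dotProduct, dotProduct_mulVec_self_of_skew hB, smul_zero, add_zero]
    rw [radialPhase, ← hd]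
    simp only [dotProduct, mulVec, Complex.ofReal_sum, Complex.ofReal_mul, Finset.mul_sum]
    rw [Finset.sum_comm]
    refine Finset.sum_congr rfl fun k _ => Finset.sum_congr rfl fun j _ => ?_
    ring
  simp only [_root_.mgd, smul_sub, Finset.sum_sub_distrib]
  rw [← hx, mul_neg, neg_smul, ← sub_eq_add_neg, mul_smul, ← hA, Finset.sum_smul]
  simp only [mul_smul]

/-- The value of `v` at `Z` is controlled by averages of its covariant derivatives of order up to
`n + 1` over cubes with a corner at `Z`. -/
theorem norm_le_sum_integral_unitCube [CompleteSpace F] (hB : Bᵀ = -B)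
    {v : (Fin (2 * n) → ℝ) → F} (hv : ContDiff ℝ (⊤ : ℕ∞) v) {T : ℝ} (hT : 0 ≤ T) (q : ℕ)
    (Z x : Fin (2 * n) → ℝ) (hx : x ∈ Set.Icc (0 : Fin (2 * n) → ℝ) 1) :
    ‖v Z‖ ≤ ∑ l ∈ Finset.range (q + 1),
        T ^ l * ∑ i : Fin l → Fin (2 * n), ‖mgdIter B p (List.ofFn i) v (Z + T • x)‖ +
      ∫ t in (0 : ℝ)..T, t ^ q *
        ∑ i : Fin (q + 1) → Fin (2 * n), ‖mgdIter B p (List.ofFn i) v (Z + t • x)‖ := by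
  set f : ℕ → ℝ → F := fun l t => ∑ i : Fin l → Fin (2 * n), (∏ a, (x (i a) : ℂ)) •
    (Complex.exp (-(radialPhase B p Z x * t)) • mgdIter B p (List.ofFn i) v (Z + t • x)) with hfdef
  have hf (l : ℕ) (t : ℝ) : HasDerivAt (f l) (f (l + 1) t) t := by
    have h := HasDerivAt.fun_sum (u := Finset.univ) fun (i : Fin l → Fin (2 * n)) _ =>
      (hasDerivAt_radial (p := p) hB ((hv.mgdIter (B := B) (p := p) (List.ofFn i)).differentiable
        (by simp)) Z x t).const_smul (∏ a, (x (i a) : ℂ))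
    refine h.congr_deriv ?_
    simp only [hfdef]
    rw [← (Fin.consEquiv fun _ : Fin (l + 1) => Fin (2 * n)).sum_comp, Fintype.sum_prod_type_right]
    refine Finset.sum_congr rfl fun i _ => ?_
    simp only [Finset.smul_sum]
    refine Finset.sum_congr rfl fun j _ => ?_
    simp only [Fin.consEquiv, Equiv.coe_fn_mk, Fin.prod_univ_succ, List.ofFn_succ, Fin.cons_zero,
      Fin.cons_succ, mgdIter, smul_smul]
    congr 1
    ring
  have hexp (t : ℝ) : ‖Complex.exp (-(radialPhase B p Z x * t))‖ = 1 := by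
    rw [Complex.norm_exp]
    simp [radialPhase]
  have hbound (l : ℕ) (t : ℝ) :
      ‖f l t‖ ≤ ∑ i : Fin l → Fin (2 * n), ‖mgdIter B p (List.ofFn i) v (Z + t • x)‖ := by
    refine norm_sum_le_of_le _ fun i _ => ?_
    rw [norm_smul, norm_smul, hexp, one_mul, norm_prod]
    refine mul_le_of_le_one_left (norm_nonneg _) (Finset.prod_le_one (fun _ _ => norm_nonneg _) ?_)
    intro a _
    rw [Complex.norm_real, Real.norm_of_nonneg (hx.1 _)]
    exact hx.2 _
  have hcont (i : Fin (q + 1) → Fin (2 * n)) : Continuous (mgdIter B p (List.ofFn i) v) :=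
    (hv.mgdIter _).continuous
  have hfc : Continuous (f (q + 1)) :=
    continuous_iff_continuousAt.2 fun t => (hf (q + 1) t).continuousAt
  have h0 : f 0 0 = v Z := by simp [hfdef, mgdIter]
  rw [← h0]
  refine (norm_zero_le_taylor f hf hT q).trans (add_le_add ?_ ?_)
  · gcongr with l _
    exact hbound l T
  · refine intervalIntegral.integral_mono_on hT
      (by apply Continuous.intervalIntegrable; fun_prop)
      (by apply Continuous.intervalIntegrable; fun_prop) fun t ht => ?_
    have := ht.1
    gcongr
    exact hbound _ t

/-- Sobolev inequality at scale `T` for magnetic derivatives. -/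
theorem norm_le_sum_sqrt_integral [CompleteSpace F] (hB : Bᵀ = -B)
    {v : (Fin (2 * n) → ℝ) → F} (hv : ContDiff ℝ (⊤ : ℕ∞) v) (hs : HasCompactSupport v)
    {T : ℝ} (hT : 0 < T) (Z : Fin (2 * n) → ℝ) :
    ‖v Z‖ ≤ (T ^ n)⁻¹ * ∑ l ∈ Finset.range (n + 2), T ^ l *
      ∑ i : Fin l → Fin (2 * n), √(∫ y, ‖mgdIter B p (List.ofFn i) v y‖ ^ 2) := by
  set Q := Set.Icc (0 : Fin (2 * n) → ℝ) 1
  have hcont (js : List (Fin (2 * n))) : Continuous (mgdIter B p js v) := (hv.mgdIter _).continuous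
  set N : ℕ → ℝ := fun l =>
    ∑ i : Fin l → Fin (2 * n), √(∫ y, ‖mgdIter B p (List.ofFn i) v y‖ ^ 2)
  set g : ℕ → (Fin (2 * n) → ℝ) → ℝ := fun l y =>
    ∑ i : Fin l → Fin (2 * n), ‖mgdIter B p (List.ofFn i) v y‖
  have hg (l : ℕ) : Continuous (g l) := by fun_prop
  have hmean (l : ℕ) {t : ℝ} (ht : 0 < t) : ∫ x in Q, g l (Z + t • x) ≤ (t ^ n)⁻¹ * N l := by
    simp only [g, N]
    rw [integral_finsetSum _ fun i _ => Continuous.integrableOn_Icc (by fun_prop), Finset.mul_sum]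
    exact Finset.sum_le_sum fun i _ =>
      integral_unitCube_norm_le (hcont _) (hs.mgdIter _) Z ht
  have hprod : Integrable (Function.uncurry fun (t : ℝ) (x : Fin (2 * n) → ℝ) =>
      t ^ n * g (n + 1) (Z + t • x))
      ((volume.restrict (Set.uIoc 0 T)).prod (volume.restrict Q)) := by
    rw [Measure.prod_restrict, ← Measure.volume_eq_prod]
    refine IntegrableOn.mono_set (t := Set.uIcc 0 T ×ˢ Q) ?_
      (Set.prod_mono Set.uIoc_subset_uIcc subset_rfl)
    refine ContinuousOn.integrableOn_compact (isCompact_uIcc.prod isCompact_Icc) ?_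
    apply Continuous.continuousOn
    unfold Function.uncurry
    fun_prop
  have hswap := intervalIntegral_integral_swap hprod
  have hrem : ∫ x in Q, ∫ t in (0 : ℝ)..T, t ^ n * g (n + 1) (Z + t • x) ≤ N (n + 1) * T := by
    rw [← hswap]
    have h := intervalIntegral.norm_integral_le_of_norm_le_const (a := 0) (b := T)
      (f := fun t => ∫ x in Q, t ^ n * g (n + 1) (Z + t • x)) (C := N (n + 1)) fun t ht => by
        rw [Set.uIoc_of_le hT.le] at ht
        have ht0 := ht.1
        have hg0 : 0 ≤ ∫ x in Q, g (n + 1) (Z + t • x) :=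
          integral_nonneg fun x => Finset.sum_nonneg fun i _ => norm_nonneg _
        rw [integral_const_mul, Real.norm_of_nonneg (by positivity)]
        calc t ^ n * ∫ x in Q, g (n + 1) (Z + t • x) ≤ t ^ n * ((t ^ n)⁻¹ * N (n + 1)) := by
              gcongr
              exact hmean _ ht0
          _ = N (n + 1) := by field_simp
    rw [sub_zero, abs_of_pos hT] at h
    exact (le_abs_self _).trans h
  have hgi (l : ℕ) : IntegrableOn (fun x => T ^ l * g l (Z + T • x)) Q :=
    Continuous.integrableOn_Icc (by fun_prop)
  have hri : IntegrableOn (fun x => ∫ t in (0 : ℝ)..T, t ^ n * g (n + 1) (Z + t • x)) Q := by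
    simpa only [intervalIntegral.integral_of_le hT.le, Set.uIoc_of_le hT.le]
      using! hprod.integral_prod_right
  have hsum : IntegrableOn (fun x => ∑ l ∈ Finset.range (n + 1), T ^ l * g l (Z + T • x)) Q :=
    integrable_finsetSum _ fun l _ => hgi l
  calc ‖v Z‖ = ∫ _ in Q, ‖v Z‖ := by rw [setIntegral_const, volume_unitCube, one_smul]
    _ ≤ ∫ x in Q, ((∑ l ∈ Finset.range (n + 1), T ^ l * g l (Z + T • x)) +
        ∫ t in (0 : ℝ)..T, t ^ n * g (n + 1) (Z + t • x)) :=
      setIntegral_mono_on continuous_const.integrableOn_Icc (hsum.add hri) measurableSet_Icc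
        fun x hx => norm_le_sum_integral_unitCube hB hv hT.le n Z x hx
    _ = (∑ l ∈ Finset.range (n + 1), T ^ l * ∫ x in Q, g l (Z + T • x)) +
        ∫ x in Q, ∫ t in (0 : ℝ)..T, t ^ n * g (n + 1) (Z + t • x) := by
      rw [integral_add hsum hri, integral_finsetSum _ fun l _ => hgi l]
      simp only [integral_const_mul]
    _ ≤ (∑ l ∈ Finset.range (n + 1), T ^ l * ((T ^ n)⁻¹ * N l)) + N (n + 1) * T := by
      gcongr with l _
      exact hmean l hT
    _ = (T ^ n)⁻¹ * ∑ l ∈ Finset.range (n + 2), T ^ l * N l := by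
      rw [Finset.sum_range_succ _ (n + 1), mul_add, Finset.mul_sum]
      congr 1
      · exact Finset.sum_congr rfl fun l _ => by ring
      · field_simp
        ring

end MagneticDerivative

theorem sqrt_integral_mgdIter_le {n r : ℕ} (B : Matrix (Fin (2 * n)) (Fin (2 * n)) ℝ) {p m : ℕ}
    (hp : 0 < p) (u : (Fin (2 * n) → ℝ) → EuclideanSpace ℂ (Fin r)) (js : List (Fin (2 * n)))
    (hjs : js.length ≤ m) :
    √(∫ y, ‖mgdIter B p js u y‖ ^ 2) ≤ √p ^ js.length * √(sobSq B p m u) := by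
  have hp' : (0 : ℝ) < p := by exact_mod_cast hp
  have h0 (js : List (Fin (2 * n))) : 0 ≤ ∫ y, ‖mgdIter B p js u y‖ ^ 2 :=
    integral_nonneg fun y => sq_nonneg _
  have h1 : ∫ y, ‖mgdIter B p js u y‖ ^ 2 ≤
      ∑ i : Fin js.length → Fin (2 * n), ∫ y, ‖mgdIter B p (List.ofFn i) u y‖ ^ 2 := by
    have := Finset.single_le_sum (s := Finset.univ) (a := js.get)
      (f := fun i : Fin js.length → Fin (2 * n) => ∫ y, ‖mgdIter B p (List.ofFn i) u y‖ ^ 2)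
      (fun i _ => h0 _) (Finset.mem_univ _)
    rwa [List.ofFn_get] at this
  have h2 : (p : ℝ)⁻¹ ^ js.length * ∑ i : Fin js.length → Fin (2 * n),
      ∫ y, ‖mgdIter B p (List.ofFn i) u y‖ ^ 2 ≤ sobSq B p m u :=
    Finset.single_le_sum (s := Finset.range (m + 1)) (a := js.length)
      (f := fun l => (p : ℝ)⁻¹ ^ l * ∑ i : Fin l → Fin (2 * n),
        ∫ y, ‖mgdIter B p (List.ofFn i) u y‖ ^ 2)
      (fun l _ => mul_nonneg (by positivity) (Finset.sum_nonneg fun i _ => h0 _))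
      (Finset.mem_range.2 (by omega))
  have h3 : ∫ y, ‖mgdIter B p js u y‖ ^ 2 ≤ (√p ^ js.length) ^ 2 * sobSq B p m u := by
    rw [pow_right_comm, Real.sq_sqrt hp'.le, ← inv_mul_le_iff₀ (by positivity),
      ← inv_pow]
    exact (mul_le_mul_of_nonneg_left h1 (by positivity)).trans h2
  refine (Real.sqrt_le_sqrt h3).trans_eq ?_
  rw [Real.sqrt_mul (by positivity), Real.sqrt_sq (by positivity)]

/-- Rescaled Sobolev embedding: for `m > k + n`,
`sup_Z |∇_{j_1}⋯∇_{j_k} u(Z)| ≤ C p^{(n+k)/2} ‖u‖_{p,m}`. -/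
theorem stmt11 (n r : ℕ) (hn : 1 ≤ n) (hr : 1 ≤ r)
    (B : Matrix (Fin (2*n)) (Fin (2*n)) ℝ) (hB : Bᵀ = -B)
    (k m : ℕ) (hkm : k + n < m) :
    ∃ C > 0, ∀ p : ℕ, 0 < p →
      ∀ u : (Fin (2*n) → ℝ) → EuclideanSpace ℂ (Fin r),
        ContDiff ℝ (⊤ : ℕ∞) u → HasCompactSupport u →
        ∀ js : List (Fin (2*n)), js.length = k →
          ∀ Z, ‖mgdIter B p js u Z‖ ≤
            C * (p : ℝ) ^ (((n : ℝ) + (k : ℝ)) / 2) * Real.sqrt (sobSq B p m u) := by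
  refine ⟨∑ l ∈ Finset.range (n + 2), (2 * n : ℝ) ^ l, ?_, ?_⟩
  · exact Finset.sum_pos (fun l _ => by positivity) (by simp)
  intro p hp u hu hsu js hjs Z
  have hp' : (0 : ℝ) < p := by exact_mod_cast hp
  set s := √(p : ℝ) with hs
  have hs0 : 0 < s := Real.sqrt_pos.2 hp'
  have hpow : (p : ℝ) ^ (((n : ℝ) + (k : ℝ)) / 2) = s ^ (n + k) := by
    rw [hs, Real.sqrt_eq_rpow, ← Real.rpow_natCast, ← Real.rpow_mul hp'.le]
    congr 1
    push_cast
    ring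
  have hN (l : ℕ) (hl : l < n + 2) :
      ∑ i : Fin l → Fin (2 * n), √(∫ y, ‖mgdIter B p (List.ofFn i) (mgdIter B p js u) y‖ ^ 2) ≤
        (2 * n : ℝ) ^ l * (s ^ (l + k) * √(sobSq B p m u)) := by
    refine (Finset.sum_le_card_nsmul _ _ (s ^ (l + k) * √(sobSq B p m u)) fun i _ => ?_).trans_eq ?_
    · rw [← mgdIter_append]
      have h := sqrt_integral_mgdIter_le B hp u (List.ofFn i ++ js) (m := m)
        (by simp only [List.length_append, List.length_ofFn]; omega)
      rwa [List.length_append, List.length_ofFn, hjs] at h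
    · simp
  refine (norm_le_sum_sqrt_integral (p := p) hB (hu.mgdIter js) (hsu.mgdIter js)
    (inv_pos.2 hs0) Z).trans ?_
  rw [hpow, Finset.mul_sum, Finset.sum_mul, Finset.sum_mul]
  refine Finset.sum_le_sum fun l hl => ?_
  calc (s⁻¹ ^ n)⁻¹ * (s⁻¹ ^ l * _)
      ≤ (s⁻¹ ^ n)⁻¹ * (s⁻¹ ^ l * ((2 * n : ℝ) ^ l * (s ^ (l + k) * √(sobSq B p m u)))) := by
        gcongr
        exact hN l (Finset.mem_range.1 hl)
    _ = (2 * n : ℝ) ^ l * s ^ (n + k) * √(sobSq B p m u) := by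
        simp only [pow_add, inv_pow]
        field_simp
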